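/- arXiv:2110.11804 — 3 statements merged into one kernel-verified Lean document; each statement's English description precedes it below -/
import Mathlib

section
/- In the linear model with stochastic pruning, let g(v) = (1/(2M)) Σ_j (ψ(x_j)ᵀv − y_j)² denote the deterministic empirical risk as a function of the weight vector v ∈ ℝ^D, and let W̄ be the mean vector with W̄_i = λ_i w_i. Then the derivative of the empirical Gibbs risk with respect to the underlying weight w_i satisfies ∂R̂(λ,w)/∂w_i = λ_i · (∂g/∂v_i)(W̄) + λ_i (1 − λ_i) w_i Σ_{ii}. In particular, the effective learning rate of weight i is scaled by λ_i, and an additional label-independent term λ_i(1−λ_i) w_i Σ_{ii} appears relative to the gradient of the mean predictor. -/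
open Finset

/-- Probability of a given mask `b` under the product Bernoulli distribution with
keep-probabilities `lam`. -/
noncomputable def maskProb {D : ℕ} (lam : Fin D → ℝ) (b : Fin D → Bool) : ℝ :=
  ∏ i, if b i then lam i else 1 - lam i

/-- Empirical Gibbs risk under squared loss of the stochastic predictor obtained by
independently keeping weight `w i` with probability `lam i`:
`R̂(λ, w) = (1/(2M)) E[ Σ_j (ψ(x_j)ᵀ W - y_j)² ]`, the expectation over the mask
written as a finite sum over all masks. -/
noncomputable def gibbsRisk {d D M : ℕ} (ψ : (Fin d → ℝ) → Fin D → ℝ)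
    (x : Fin M → Fin d → ℝ) (y : Fin M → ℝ) (lam w : Fin D → ℝ) : ℝ :=
  ∑ b : Fin D → Bool, maskProb lam b *
    ((1 / (2 * (M : ℝ))) * ∑ j, (∑ i, ψ (x j) i * (if b i then w i else 0) - y j) ^ 2)

/-- Empirical feature covariance `Σ i k = (1/M) Σ_j ψ(x_j)_i ψ(x_j)_k`. -/
noncomputable def empCov {d D M : ℕ} (ψ : (Fin d → ℝ) → Fin D → ℝ)
    (x : Fin M → Fin d → ℝ) (i k : Fin D) : ℝ :=
  (1 / (M : ℝ)) * ∑ j, ψ (x j) i * ψ (x j) k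

/-- Feature alignment vector `A i = (1/M) Σ_j ψ(x_j)_i y_j`. -/
noncomputable def featAlign {d D M : ℕ} (ψ : (Fin d → ℝ) → Fin D → ℝ)
    (x : Fin M → Fin d → ℝ) (y : Fin M → ℝ) (i : Fin D) : ℝ :=
  (1 / (M : ℝ)) * ∑ j, ψ (x j) i * y j

/-- Deterministic empirical risk `g(v) = (1/(2M)) Σ_j (ψ(x_j)ᵀ v - y_j)²`. -/
noncomputable def detRisk {d D M : ℕ} (ψ : (Fin d → ℝ) → Fin D → ℝ)
    (x : Fin M → Fin d → ℝ) (y : Fin M → ℝ) (v : Fin D → ℝ) : ℝ :=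
  (1 / (2 * (M : ℝ))) * ∑ j, (∑ i, ψ (x j) i * v i - y j) ^ 2

/-- Bias-variance decomposition of the squared error of a sum of independently masked terms. -/
theorem sum_maskProb_mul_sq {D : ℕ} (lam a : Fin D → ℝ) (c : ℝ) :
    ∑ b : Fin D → Bool, maskProb lam b * (∑ k, (if b k then a k else 0) - c) ^ 2
      = (∑ k, lam k * a k - c) ^ 2 + ∑ k, lam k * (1 - lam k) * a k ^ 2 := by
  induction D generalizing c with
  | zero => simp [maskProb]
  | succ n ih =>
    have h_tail (c : ℝ) := ih (fun k => lam k.succ) (fun k => a k.succ) c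
    have h_shift (s : ℝ) : a 0 + s - c = s - (c - a 0) := by ring
    rw [← (Fin.consEquiv fun _ => Bool).sum_comp, Fintype.sum_prod_type]
    simp only [maskProb, Fin.consEquiv_apply, Fin.prod_univ_succ, Fin.sum_univ_succ, Fin.cons_zero,
      Fin.cons_succ, Fintype.sum_bool, if_true, Bool.false_eq_true, if_false, mul_assoc,
      ← Finset.mul_sum, zero_add, h_shift] at h_tail ⊢
    rw [h_tail, h_tail]
    ring

theorem gibbsRisk_eq_detRisk_add {d D M : ℕ} (ψ : (Fin d → ℝ) → Fin D → ℝ)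
    (x : Fin M → Fin d → ℝ) (y : Fin M → ℝ) (lam w : Fin D → ℝ) :
    gibbsRisk ψ x y lam w = detRisk ψ x y (fun k => lam k * w k)
      + ∑ k, lam k * (1 - lam k) * empCov ψ x k k / 2 * w k ^ 2 := by
  have h_point (j : Fin M) := sum_maskProb_mul_sq lam (fun k => ψ (x j) k * w k) (y j)
  have h_var : ∑ k, lam k * (1 - lam k) * empCov ψ x k k / 2 * w k ^ 2
      = 1 / (2 * (M : ℝ)) * ∑ j, ∑ k, lam k * (1 - lam k) * (ψ (x j) k * w k) ^ 2 := by
    rw [Finset.sum_comm, Finset.mul_sum]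
    refine Finset.sum_congr rfl fun k _ => ?_
    simp only [empCov, Finset.mul_sum, Finset.sum_mul, Finset.sum_div]
    exact Finset.sum_congr rfl fun j _ => by ring
  rw [h_var, detRisk, ← mul_add, ← Finset.sum_add_distrib]
  simp only [gibbsRisk, mul_ite, mul_zero, mul_left_comm (maskProb lam _), ← Finset.mul_sum]
  congr 1
  simp only [Finset.mul_sum]
  rw [Finset.sum_comm]
  refine Finset.sum_congr rfl fun j _ => ?_
  rw [h_point]
  simp only [mul_left_comm (lam _)]

theorem hasDerivAt_sum_mul_update_sq {ι : Type*} [Fintype ι] [DecidableEq ι] (c w : ι → ℝ)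
    (i : ι) (s : ℝ) :
    HasDerivAt (fun t => ∑ k, c k * Function.update w i t k ^ 2) (2 * c i * s) s := by
  have h_split : (fun t => ∑ k, c k * Function.update w i t k ^ 2)
      = fun t => c i * t ^ 2 + ∑ k ∈ Finset.univ.erase i, c k * w k ^ 2 := by
    funext t
    rw [← Finset.add_sum_erase _ _ (Finset.mem_univ i), Function.update_self]
    congr 1
    refine Finset.sum_congr rfl fun k hk => ?_
    rw [Function.update_of_ne (Finset.ne_of_mem_erase hk)]
  rw [h_split]
  refine (((hasDerivAt_pow 2 s).const_mul (c i)).add_const _).congr_deriv ?_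
  norm_num
  ring

theorem differentiable_detRisk {d D M : ℕ} (ψ : (Fin d → ℝ) → Fin D → ℝ)
    (x : Fin M → Fin d → ℝ) (y : Fin M → ℝ) : Differentiable ℝ (detRisk ψ x y) := by
  unfold detRisk
  fun_prop

/-- the derivative of the empirical Gibbs risk with respect to the
underlying weight `w_i` satisfies
`∂R̂/∂w_i = λ_i (∂g/∂v_i)(W̄) + λ_i (1-λ_i) w_i Σ_{ii}`, where `W̄_i = λ_i w_i`;
the effective learning rate is scaled by `λ_i`, plus an additional
label-independent term. -/
theorem gibbs_risk_weight_deriv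
    (d D M : ℕ) (hM : 0 < M) (ψ : (Fin d → ℝ) → Fin D → ℝ)
    (x : Fin M → Fin d → ℝ) (y : Fin M → ℝ)
    (w lam : Fin D → ℝ) (hlam : ∀ i, lam i ∈ Set.Icc (0:ℝ) 1) (i : Fin D) :
    deriv (fun t => gibbsRisk ψ x y lam (Function.update w i t)) (w i)
      = lam i *
          deriv (fun t => detRisk ψ x y (Function.update (fun k => lam k * w k) i t))
            (lam i * w i)
        + lam i * (1 - lam i) * w i * empCov ψ x i i := by
  have h_eq : (fun t => gibbsRisk ψ x y lam (Function.update w i t)) = fun t =>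
      detRisk ψ x y (Function.update (fun k => lam k * w k) i (lam i * t))
        + ∑ k, lam k * (1 - lam k) * empCov ψ x k k / 2 * Function.update w i t k ^ 2 := by
    funext t
    rw [gibbsRisk_eq_detRisk_add]
    congr 2
    funext k
    exact Function.apply_update (fun k s => lam k * s) w i t k
  have h_var := hasDerivAt_sum_mul_update_sq
    (fun k => lam k * (1 - lam k) * empCov ψ x k k / 2) w i (w i)
  have h_diff : Differentiable ℝ fun t =>
      detRisk ψ x y (Function.update (fun k => lam k * w k) i t) :=
    (differentiable_detRisk ψ x y).comp fun t => (hasDerivAt_update _ i t).differentiableAt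
  have h_mean : HasDerivAt
      (fun t => detRisk ψ x y (Function.update (fun k => lam k * w k) i (lam i * t)))
      (lam i * deriv (fun t => detRisk ψ x y (Function.update (fun k => lam k * w k) i t))
        (lam i * w i)) (w i) := by
    rw [mul_comm (lam i)]
    exact (h_diff (lam i * w i)).hasDerivAt.comp (w i) (hasDerivAt_const_mul (lam i))
  rw [h_eq, (h_mean.fun_add h_var).deriv]
  ring
end

section
/- (Theorem 1: data-dependent-prior PAC-Bayes bound.) Let Z be a measurable space, 𝒟 a probability measure on Z, H a measurable space of hypotheses, and ℓ: H × Z → [0,1] a measurable loss. Fix N ∈ ℕ, a prefix size M < N with α = M/N, and δ ∈ (0,1). Let P: Z^M → (probability measures on H) be any measurable mapping ('data-dependent prior' depending only on the first M sample points S_P). Then with probability at least 1 − δ over S = (z_1,…,z_N) ~ 𝒟^N, it holds simultaneously for all probability measures Q on H that R_𝒟(Q) ≤ R̂_{S∖S_P}(Q) + min( ε + √(ε(ε + 2 R̂_{S∖S_P}(Q))), √(ε/2) ), where R̂_{S∖S_P}(Q) is the empirical Gibbs risk on the remaining N − M points and ε = ( KL(Q‖P(S_P)) + log( 2√((1−α)N)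 / δ ) ) / ((1−α)N). -/
open MeasureTheory Finset
open scoped ENNReal Classical

/-- Kullback--Leibler divergence `KL(Q‖P)`: `∫ log (dQ/dP) dQ` when `Q ≪ P` (and the
integrand is `Q`-integrable), and `+∞` otherwise. -/
noncomputable def klDiv {H : Type*} [MeasurableSpace H] (Q P : Measure H) : ℝ≥0∞ :=
  if Q ≪ P ∧ Integrable (fun h => Real.log ((Q.rnDeriv P h).toReal)) Q then
    ENNReal.ofReal (∫ h, Real.log ((Q.rnDeriv P h).toReal) ∂Q)
  else ⊤

/-- Binary Kullback--Leibler divergence `klbin(q‖p)`, extended by continuity to the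
endpoints `p ∈ {0,1}` (taking the value `⊤` there unless `q = p`). -/
noncomputable def klBin (q p : ℝ) : ℝ≥0∞ :=
  if p ≤ 0 ∨ 1 ≤ p then (if q = p then 0 else ⊤)
  else ENNReal.ofReal (q * Real.log (q / p) + (1 - q) * Real.log ((1 - q) / (1 - p)))

/-- Inverse binary KL divergence: `klinv(a, ε) = sup { p ∈ [0,1] : klbin(a‖p) ≤ ε }`. -/
noncomputable def klInv (a : ℝ) (ε : ℝ≥0∞) : ℝ :=
  sSup {p : ℝ | p ∈ Set.Icc (0:ℝ) 1 ∧ klBin a p ≤ ε}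

theorem integral_log_unit_le (n : ℕ) :
    (n + 1 : ℝ) * Real.log (n + 1) - n * Real.log n - 1 ≤ Real.log (n + 1 / 2) := by
  have hc : (0 : ℝ) < n + 1 / 2 := by positivity
  have hint : ∫ x in (n : ℝ)..(n + 1), (Real.log (n + 1 / 2) + (x - (n + 1 / 2)) / (n + 1 / 2))
      = Real.log (n + 1 / 2) := by
    rw [intervalIntegral.integral_add (by simp) (Continuous.intervalIntegrable (by fun_prop) _ _),
      intervalIntegral.integral_div, intervalIntegral.integral_sub (by simp) (by simp)]
    simp
    left
    ring
  have hmono : ∫ x in (n : ℝ)..(n + 1), Real.log x ≤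
      ∫ x in (n : ℝ)..(n + 1), (Real.log (n + 1 / 2) + (x - (n + 1 / 2)) / (n + 1 / 2)) := by
    refine intervalIntegral.integral_mono_on_of_le_Ioo (by linarith)
      intervalIntegral.intervalIntegrable_log' (Continuous.intervalIntegrable (by fun_prop) _ _) ?_
    intro x hx
    have hx0 : 0 < x := lt_of_le_of_lt (Nat.cast_nonneg n) hx.1
    have h := Real.log_le_sub_one_of_pos (div_pos hx0 hc)
    rw [Real.log_div hx0.ne' hc.ne'] at h
    have : (x - (n + 1 / 2 : ℝ)) / (n + 1 / 2) = x / (n + 1 / 2) - 1 := by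
      field_simp
    linarith
  rw [integral_log, hint] at hmono
  linarith

/-- The ratio `(2n)! / (4ⁿ n! nⁿ)`, asymptotic to `√2 e⁻ⁿ`. -/
noncomputable def ktFactor (n : ℕ) : ℝ :=
  (2 * n).factorial / (4 ^ n * n.factorial * (n : ℝ) ^ n)

theorem ktFactor_pos (n : ℕ) : 0 < ktFactor n := by
  unfold ktFactor
  rcases Nat.eq_zero_or_pos n with rfl | hn
  · simp
  · positivity

theorem ktFactor_succ {n : ℕ} (hn : 1 ≤ n) : ktFactor n ≤ Real.exp 1 * ktFactor (n + 1) := by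
  have hn0 : (0 : ℝ) < n := by exact_mod_cast hn
  have hratio : ktFactor (n + 1) = ktFactor n * ((n + 1 / 2) * n ^ n / (n + 1 : ℝ) ^ (n + 1)) := by
    unfold ktFactor
    rw [show 2 * (n + 1) = 2 * n + 1 + 1 by ring]
    simp only [Nat.factorial_succ]
    push_cast
    field_simp
    ring
  have hone : 1 ≤ Real.exp 1 * ((n + 1 / 2) * n ^ n / (n + 1 : ℝ) ^ (n + 1)) := by
    rw [← Real.log_nonneg_iff (by positivity), Real.log_mul (by positivity) (by positivity),
      Real.log_exp, Real.log_div (by positivity) (by positivity),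
      Real.log_mul (by positivity) (by positivity), Real.log_pow, Real.log_pow]
    have := integral_log_unit_le n
    push_cast
    linarith
  rw [hratio]
  nlinarith [ktFactor_pos n]

theorem exp_one_div_two_le_exp_mul_ktFactor {n : ℕ} (hn : 1 ≤ n) :
    Real.exp 1 / 2 ≤ Real.exp n * ktFactor n := by
  induction n, hn using Nat.le_induction with
  | base => norm_num [ktFactor]; linarith
  | succ n hn ih =>
    refine ih.trans ?_
    push_cast
    rw [Real.exp_add, mul_assoc]
    exact mul_le_mul_of_nonneg_left (ktFactor_succ hn) (Real.exp_pos _).le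

theorem factorial_mul_exp_le {m : ℕ} (hm : 1 ≤ m) :
    (m.factorial : ℝ) * Real.exp m ≤ Real.exp 1 * Real.sqrt m * (m : ℝ) ^ m := by
  obtain ⟨n, rfl⟩ : ∃ n, m = n + 1 := ⟨m - 1, by omega⟩
  have h := Stirling.stirlingSeq'_antitone (Nat.zero_le n)
  simp only [Function.comp, Nat.succ_eq_add_one, zero_add, Stirling.stirlingSeq_one] at h
  rw [Stirling.stirlingSeq, div_le_div_iff₀ (by positivity) (by positivity),
    Real.sqrt_mul (by norm_num), div_pow, ← Real.exp_nat_mul, mul_one] at h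
  have h2 : (0 : ℝ) < Real.sqrt 2 := by positivity
  have he := Real.exp_pos ((n + 1 : ℕ) : ℝ)
  have h3 := mul_le_mul_of_nonneg_right h (div_pos he h2).le
  refine le_trans (le_of_eq ?_) (h3.trans (le_of_eq ?_))
  · field_simp
  · field_simp

/-- Krichevsky--Trofimov mass of a binary word with `k` ones and `j` zeros. -/
noncomputable def ktMass (k j : ℕ) : ℝ :=
  (2 * k).factorial * (2 * j).factorial /
    (4 ^ (k + j) * k.factorial * j.factorial * (k + j).factorial)

theorem ktMass_eq_add (k j : ℕ) : ktMass k j = ktMass k (j + 1) + ktMass (k + 1) j := by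
  unfold ktMass
  rw [show 2 * (k + 1) = 2 * k + 1 + 1 by ring, show 2 * (j + 1) = 2 * j + 1 + 1 by ring,
    show k + 1 + j = k + j + 1 by ring, ← add_assoc]
  simp only [Nat.factorial_succ]
  push_cast
  field_simp
  ring

theorem sum_choose_mul_ktMass (m : ℕ) :
    ∑ k ∈ range (m + 1), (m.choose k : ℝ) * ktMass k (m - k) = 1 := by
  rw [← Finset.Nat.sum_antidiagonal_eq_sum_range_succ (fun k j => (m.choose k : ℝ) * ktMass k j)]
  induction m with
  | zero => simp [ktMass]
  | succ m ih =>
    rw [Finset.sum_antidiagonal_choose_succ_mul, ← Finset.sum_add_distrib, ← ih]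
    refine Finset.sum_congr rfl fun x hx => ?_
    rw [HasAntidiagonal.mem_antidiagonal] at hx
    rw [Nat.choose_symm_of_eq_add hx.symm, ← mul_add, ← ktMass_eq_add]

theorem pow_mul_pow_le_ktMass (k j : ℕ) (hkj : 1 ≤ k + j) :
    ((k : ℝ) / (k + j : ℕ)) ^ k * ((j : ℝ) / (k + j : ℕ)) ^ j
      ≤ 2 * Real.sqrt (k + j : ℕ) * ktMass k j := by
  set m := k + j with hm
  have hm0 : (0 : ℝ) < m := by exact_mod_cast hkj
  have hk : (0 : ℝ) < (k : ℝ) ^ k := by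
    rcases Nat.eq_zero_or_pos k with h | h
    · simp [h]
    · positivity
  have hj : (0 : ℝ) < (j : ℝ) ^ j := by
    rcases Nat.eq_zero_or_pos j with h | h
    · simp [h]
    · positivity
  have hmass : ktMass k j = ktFactor k * ktFactor j * k ^ k * j ^ j / m.factorial := by
    unfold ktMass ktFactor
    rw [← hm, hm, pow_add]
    field_simp
  have hexp : Real.exp 1 / 2 ≤ Real.exp m * (ktFactor k * ktFactor j) := by
    have he : (2 : ℝ) ≤ Real.exp 1 := by linarith [Real.add_one_le_exp (1 : ℝ)]
    have hsplit : Real.exp m * (ktFactor k * ktFactor j)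
        = (Real.exp k * ktFactor k) * (Real.exp j * ktFactor j) := by
      rw [hm]; push_cast; rw [Real.exp_add]; ring
    rw [hsplit]
    have hzero : Real.exp (0 : ℕ) * ktFactor 0 = 1 := by simp [ktFactor]
    rcases Nat.eq_zero_or_pos k with h | h
    · rw [h, hzero, one_mul]
      exact exp_one_div_two_le_exp_mul_ktFactor (by omega)
    rcases Nat.eq_zero_or_pos j with h' | h'
    · rw [h', hzero, mul_one]
      exact exp_one_div_two_le_exp_mul_ktFactor (by omega)
    have h1 := exp_one_div_two_le_exp_mul_ktFactor h
    have h2 := exp_one_div_two_le_exp_mul_ktFactor h'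
    nlinarith
  have hfact : (m.factorial : ℝ) ≤ 2 * Real.sqrt m * m ^ m * (ktFactor k * ktFactor j) := by
    have h := factorial_mul_exp_le hkj
    have hpos : 0 < 2 * Real.sqrt m * (m : ℝ) ^ m := by positivity
    have h' := mul_le_mul_of_nonneg_left hexp hpos.le
    refine le_of_mul_le_mul_right ?_ (Real.exp_pos (m : ℝ))
    linarith
  rw [hmass, div_pow, div_pow, div_mul_div_comm, ← pow_add, ← hm, mul_div_assoc',
    div_le_div_iff₀ (by positivity) (by positivity)]
  have := mul_le_mul_of_nonneg_left hfact (mul_pos hk hj).le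
  linarith

theorem sum_choose_mul_pow_mul_pow_le {m : ℕ} (hm : 1 ≤ m) :
    ∑ k ∈ range (m + 1), (m.choose k : ℝ) *
      (((k : ℝ) / m) ^ k * (1 - (k : ℝ) / m) ^ (m - k)) ≤ 2 * Real.sqrt m := by
  have hm0 : (0 : ℝ) < m := by exact_mod_cast hm
  calc _ ≤ ∑ k ∈ range (m + 1), 2 * Real.sqrt m * ((m.choose k : ℝ) * ktMass k (m - k)) := by
        refine Finset.sum_le_sum fun k hk => ?_
        have hkm : k ≤ m := by simpa [Nat.lt_succ_iff] using hk
        have h := pow_mul_pow_le_ktMass k (m - k) (by omega)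
        rw [Nat.add_sub_cancel' hkm, Nat.cast_sub hkm, sub_div, div_self hm0.ne'] at h
        have := mul_le_mul_of_nonneg_left h (Nat.cast_nonneg (m.choose k))
        linarith
    _ = 2 * Real.sqrt m := by rw [← Finset.mul_sum, sum_choose_mul_ktMass, mul_one]

/-- Binary relative entropy `q log (q/p) + (1-q) log ((1-q)/(1-p))`, for `p ∈ (0,1)`. -/
noncomputable def binEntropyRel (q p : ℝ) : ℝ :=
  q * Real.log (q / p) + (1 - q) * Real.log ((1 - q) / (1 - p))

theorem sub_le_mul_log_div {x y : ℝ} (hx : 0 ≤ x) (hy : 0 < y) :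
    x - y ≤ x * Real.log (x / y) := by
  have h := InformationTheory.klFun_nonneg (div_nonneg hx hy.le)
  rw [InformationTheory.klFun_apply] at h
  have h' := mul_le_mul_of_nonneg_left h hy.le
  have e : y * (x / y * Real.log (x / y) + 1 - x / y) = x * Real.log (x / y) + y - x := by
    field_simp
  linarith

theorem binEntropyRel_nonneg {q p : ℝ} (hq : q ∈ Set.Icc (0 : ℝ) 1) (hp : p ∈ Set.Ioo (0 : ℝ) 1) :
    0 ≤ binEntropyRel q p := by
  have h1 := sub_le_mul_log_div hq.1 hp.1
  have h2 := sub_le_mul_log_div (sub_nonneg.2 hq.2) (sub_pos.2 hp.2)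
  unfold binEntropyRel
  linarith

theorem half_sq_le_klFun {x : ℝ} (hx : x ∈ Set.Icc (0 : ℝ) 1) :
    (1 - x) ^ 2 / 2 ≤ InformationTheory.klFun x := by
  have hanti : AntitoneOn (fun x => InformationTheory.klFun x - (1 - x) ^ 2 / 2)
      (Set.Icc (0 : ℝ) 1) := by
    refine antitoneOn_of_hasDerivWithinAt_nonpos (f' := fun x => Real.log x - (x - 1))
      (convex_Icc 0 1) ?_ ?_ ?_
    · exact (InformationTheory.continuous_klFun.sub (by fun_prop)).continuousOn
    · intro x hx
      rw [interior_Icc] at hx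
      have h := (InformationTheory.hasDerivAt_klFun hx.1.ne').sub
        ((((hasDerivAt_id x).const_sub 1).pow 2).div_const 2)
      refine (h.congr_deriv ?_).hasDerivWithinAt
      simp
      ring
    · intro x hx
      rw [interior_Icc] at hx
      have := Real.log_le_sub_one_of_pos hx.1
      linarith
  have := hanti hx (Set.right_mem_Icc.2 zero_le_one) hx.2
  simp only [InformationTheory.klFun_one, sub_self] at this
  linarith

theorem sq_div_le_binEntropyRel {q p : ℝ} (hq : 0 ≤ q) (hqp : q ≤ p)
    (hp : p ∈ Set.Ioo (0 : ℝ) 1) : (p - q) ^ 2 / (2 * p) ≤ binEntropyRel q p := by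
  have hp0 := hp.1
  have h1 := half_sq_le_klFun (x := q / p)
    ⟨div_nonneg hq hp.1.le, (div_le_one hp.1).2 hqp⟩
  rw [InformationTheory.klFun_apply] at h1
  have h1' := mul_le_mul_of_nonneg_left h1 hp.1.le
  have e : p * (q / p * Real.log (q / p) + 1 - q / p) = q * Real.log (q / p) + p - q := by
    field_simp
  have e2 : p * ((1 - q / p) ^ 2 / 2) = (p - q) ^ 2 / (2 * p) := by
    field_simp
  have h2 := sub_le_mul_log_div (sub_nonneg.2 (hqp.trans hp.2.le)) (sub_pos.2 hp.2)
  unfold binEntropyRel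
  linarith

/-- One-sided Pinsker inequality for Bernoulli laws. -/
theorem two_mul_sq_le_binEntropyRel {q p : ℝ} (hq : 0 ≤ q) (hqp : q ≤ p)
    (hp : p ∈ Set.Ioo (0 : ℝ) 1) : 2 * (p - q) ^ 2 ≤ binEntropyRel q p := by
  have hq1 : q < 1 := hqp.trans_lt hp.2
  have hmono : MonotoneOn
      (fun t => -(q * Real.log t) - (1 - q) * Real.log (1 - t) - 2 * (t - q) ^ 2)
      (Set.Icc q p) := by
    refine monotoneOn_of_hasDerivWithinAt_nonneg
      (f' := fun t => -(q * t⁻¹) - (1 - q) * (-1 / (1 - t)) - 4 * (t - q))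
      (convex_Icc q p) ?_ ?_ ?_
    · have h1 : ContinuousOn (fun t => q * Real.log t) (Set.Icc q p) := by
        rcases hq.eq_or_lt with h | h
        · simp only [← h, zero_mul]; exact continuousOn_const
        · exact continuousOn_const.mul
            (Real.continuousOn_log.mono fun t ht => (h.trans_le ht.1).ne')
      have h2 : ContinuousOn (fun t : ℝ => Real.log (1 - t)) (Set.Icc q p) :=
        ContinuousOn.log (by fun_prop) fun t ht => (sub_pos.2 (ht.2.trans_lt hp.2)).ne'
      exact (h1.neg.sub (continuousOn_const.mul h2)).sub (by fun_prop)
    · intro t ht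
      rw [interior_Icc] at ht
      have ht0 : t ≠ 0 := (hq.trans_lt ht.1).ne'
      have ht1 : 1 - t ≠ 0 := (sub_pos.2 (ht.2.trans hp.2)).ne'
      have h1 := ((Real.hasDerivAt_log ht0).const_mul q).neg
      have h2 := (((hasDerivAt_id t).const_sub 1).log ht1).const_mul (1 - q)
      have h3 := (((hasDerivAt_id t).sub_const q).pow 2).const_mul 2
      refine (((h1.sub h2).sub h3).congr_deriv ?_).hasDerivWithinAt
      simp
      ring
    · intro t ht
      rw [interior_Icc] at ht
      have ht0 : 0 < t := hq.trans_lt ht.1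
      have ht1 : 0 < 1 - t := sub_pos.2 (ht.2.trans hp.2)
      have e : -(q * t⁻¹) - (1 - q) * (-1 / (1 - t)) - 4 * (t - q)
          = (t - q) * (1 - 2 * t) ^ 2 / (t * (1 - t)) := by
        field_simp
        ring
      rw [e]
      have := sub_pos.2 ht.1
      positivity
  have h := hmono (Set.left_mem_Icc.2 hqp) (Set.right_mem_Icc.2 hqp) hqp
  have e1 : q * Real.log (q / p) = q * Real.log q - q * Real.log p := by
    rcases hq.eq_or_lt with h | h
    · simp [← h]
    · rw [Real.log_div h.ne' hp.1.ne']; ring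
  unfold binEntropyRel
  rw [e1, Real.log_div (sub_pos.2 hq1).ne' (sub_pos.2 hp.2).ne']
  simp only [sub_self] at h
  linarith

/-- A convex lower bound on the binary relative entropy when the empirical risk `q` is below
the true risk `p`, and `0` otherwise. -/
noncomputable def riskGap (q p : ℝ) : ℝ := max 2 (1 / (2 * p)) * (max (p - q) 0) ^ 2

theorem riskGap_nonneg (q p : ℝ) : 0 ≤ riskGap q p :=
  mul_nonneg (le_max_of_le_left zero_le_two) (sq_nonneg _)

theorem riskGap_self (p : ℝ) : riskGap p p = 0 := by simp [riskGap]

theorem riskGap_of_le {q p : ℝ} (h : p ≤ q) : riskGap q p = 0 := by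
  simp [riskGap, max_eq_right (sub_nonpos.2 h)]

theorem riskGap_le_binEntropyRel {q p : ℝ} (hq : q ∈ Set.Icc (0 : ℝ) 1)
    (hp : p ∈ Set.Ioo (0 : ℝ) 1) : riskGap q p ≤ binEntropyRel q p := by
  rcases le_total p q with h | h
  · rw [riskGap_of_le h]
    exact binEntropyRel_nonneg hq hp
  · rw [riskGap, max_eq_left (sub_nonneg.2 h), max_mul_of_nonneg _ _ (sq_nonneg _)]
    refine max_le (two_mul_sq_le_binEntropyRel hq.1 h hp) ?_
    rw [one_div_mul_eq_div]
    exact sq_div_le_binEntropyRel hq.1 h hp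

theorem riskGap_le_two {q p : ℝ} (hq : 0 ≤ q) (hp : p ∈ Set.Icc (0 : ℝ) 1) :
    riskGap q p ≤ 2 := by
  rcases le_total p q with h | h
  · rw [riskGap_of_le h]; norm_num
  · rw [riskGap, max_eq_left (sub_nonneg.2 h), max_mul_of_nonneg _ _ (sq_nonneg _)]
    have hp1 := hp.2
    have hd : (p - q) ^ 2 ≤ p ^ 2 := pow_le_pow_left₀ (sub_nonneg.2 h) (by linarith) 2
    refine max_le (by nlinarith [hp.1]) ?_
    rcases hp.1.eq_or_lt with h0 | h0
    · simp [← h0]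
    · rw [one_div_mul_eq_div, div_le_iff₀ (by positivity)]
      nlinarith

theorem quadratic_le_riskGap (q p : ℝ) {t : ℝ} (ht : 0 ≤ t) :
    4 * t * (p - q) - 2 * t ^ 2 ≤ riskGap q p := by
  have h1 : 2 * (max (p - q) 0) ^ 2 ≤ riskGap q p :=
    mul_le_mul_of_nonneg_right (le_max_left _ _) (sq_nonneg _)
  have h2 : t * (p - q) ≤ t * max (p - q) 0 := mul_le_mul_of_nonneg_left (le_max_left _ _) ht
  nlinarith [sq_nonneg (max (p - q) 0 - t)]

theorem linear_le_riskGap {q p t : ℝ} (hq : 0 ≤ q) (hp : 0 ≤ p) (ht : 0 ≤ t) :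
    t * (p - q) - t ^ 2 * p / 2 ≤ riskGap q p := by
  rcases hp.eq_or_lt with h0 | h0
  · have := riskGap_nonneg q p
    subst h0
    nlinarith [mul_nonneg ht hq]
  · have h1 : (max (p - q) 0) ^ 2 / (2 * p) ≤ riskGap q p := by
      rw [← one_div_mul_eq_div]
      exact mul_le_mul_of_nonneg_right (le_max_right _ _) (sq_nonneg _)
    refine le_trans ?_ h1
    rw [le_div_iff₀ (by positivity)]
    have h2 : t * (p - q) ≤ t * max (p - q) 0 := mul_le_mul_of_nonneg_left (le_max_left _ _) ht
    nlinarith [sq_nonneg (max (p - q) 0 - t * p), mul_le_mul_of_nonneg_right h2 hp]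

theorem convexOn_exp_mul_riskGap {a : ℝ} (ha : 0 ≤ a) (b p : ℝ) :
    ConvexOn ℝ Set.univ fun y : ℝ => Real.exp (a * riskGap (b * y) p) := by
  have hlin : ConvexOn ℝ Set.univ fun y : ℝ => p - b * y := by
    refine ⟨convex_univ, fun x _ y _ s t _ _ hst => le_of_eq ?_⟩
    simp only [smul_eq_mul]
    linear_combination -p * hst
  have hmax : ConvexOn ℝ Set.univ fun y : ℝ => max (p - b * y) 0 :=
    hlin.sup (convexOn_const 0 convex_univ)
  have hsq : ConvexOn ℝ Set.univ fun y : ℝ => (max (p - b * y) 0) ^ 2 :=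
    hmax.pow (fun _ _ => le_max_right _ _) 2
  have hgap : ConvexOn ℝ Set.univ fun y : ℝ => a * riskGap (b * y) p := by
    have := hsq.smul (mul_nonneg ha (le_max_of_le_left (b := (2 : ℝ)) (c := 1 / (2 * p)) zero_le_two))
    refine this.congr fun y _ => ?_
    simp only [smul_eq_mul, riskGap, mul_assoc]
  exact ⟨convex_univ, fun x hx y hy s t hs ht hst => (Real.exp_le_exp.2
    (hgap.2 hx hy hs ht hst)).trans (convexOn_exp.2 trivial trivial hs ht hst)⟩

theorem ConvexOn.le_sum_powerset {ι : Type*} [DecidableEq ι] {φ : ℝ → ℝ} (hφ : ConvexOn ℝ Set.univ φ)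
    (s : Finset ι) (x : ι → ℝ) (hx : ∀ i, x i ∈ Set.Icc (0 : ℝ) 1) (c : ℝ) :
    φ (c + ∑ i ∈ s, x i) ≤
      ∑ t ∈ s.powerset, (∏ i ∈ s, if i ∈ t then x i else 1 - x i) * φ (c + #t) := by
  induction s using Finset.induction_on generalizing c with
  | empty => simp
  | insert a s ha ih =>
    have hconv := hφ.2 (Set.mem_univ (c + ∑ i ∈ s, x i)) (Set.mem_univ (c + 1 + ∑ i ∈ s, x i))
      (sub_nonneg.2 (hx a).2) (hx a).1 (by ring)
    simp only [smul_eq_mul] at hconv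
    rw [show (1 - x a) * (c + ∑ i ∈ s, x i) + x a * (c + 1 + ∑ i ∈ s, x i)
      = c + ∑ i ∈ insert a s, x i by rw [Finset.sum_insert ha]; ring] at hconv
    refine hconv.trans ?_
    rw [Finset.sum_powerset_insert ha]
    refine add_le_add ?_ ?_
    · refine (mul_le_mul_of_nonneg_left (ih c) (sub_nonneg.2 (hx a).2)).trans (le_of_eq ?_)
      rw [Finset.mul_sum]
      refine Finset.sum_congr rfl fun t ht => ?_
      have hat : a ∉ t := fun h => ha (Finset.mem_powerset.1 ht h)
      rw [Finset.prod_insert ha, if_neg hat, mul_assoc]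
    · refine (mul_le_mul_of_nonneg_left (ih (c + 1)) (hx a).1).trans (le_of_eq ?_)
      rw [Finset.mul_sum]
      refine Finset.sum_congr rfl fun t ht => ?_
      have hat : a ∉ t := fun h => ha (Finset.mem_powerset.1 ht h)
      have hprod : (∏ i ∈ s, if i ∈ insert a t then x i else 1 - x i)
          = ∏ i ∈ s, if i ∈ t then x i else 1 - x i := by
        refine Finset.prod_congr rfl fun i hi => ?_
        have hia : i ≠ a := fun h => ha (h ▸ hi)
        simp [hia]
      rw [Finset.prod_insert ha, if_pos (Finset.mem_insert_self a t), hprod, mul_assoc,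
        Finset.card_insert_of_notMem hat]
      push_cast
      rw [show c + 1 + (#t : ℝ) = c + (#t + 1) by ring]

theorem sum_binomial_exp_riskGap_le {m : ℕ} (hm : 1 ≤ m) {p : ℝ} (hp : p ∈ Set.Icc (0 : ℝ) 1) :
    ∑ k ∈ range (m + 1), (m.choose k : ℝ) *
      (p ^ k * (1 - p) ^ (m - k) * Real.exp (m * riskGap ((m : ℝ)⁻¹ * k) p)) ≤
        2 * Real.sqrt m := by
  have hm0 : (0 : ℝ) < m := by exact_mod_cast hm
  have hone : (1 : ℝ) ≤ 2 * Real.sqrt m := by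
    have : (1 : ℝ) ≤ Real.sqrt m := Real.one_le_sqrt.2 (by exact_mod_cast hm)
    linarith
  rcases hp.1.eq_or_lt with h0 | h0
  · subst h0
    refine le_trans (le_of_eq ?_) hone
    rw [Finset.sum_eq_single 0]
    · simp [riskGap_self]
    · intro k _ hk
      simp [hk]
    · simp
  rcases hp.2.eq_or_lt with h1 | h1
  · subst h1
    refine le_trans (le_of_eq ?_) hone
    rw [Finset.sum_eq_single m]
    · simp [riskGap_self, hm0.ne']
    · intro k hk hkm
      have : m - k ≠ 0 := by
        have := Finset.mem_range.1 hk
        omega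
      simp [this]
    · simp
  refine le_trans (Finset.sum_le_sum fun k hk => ?_) (sum_choose_mul_pow_mul_pow_le hm)
  have hkm : k ≤ m := by simpa [Nat.lt_succ_iff] using hk
  refine mul_le_mul_of_nonneg_left ?_ (Nat.cast_nonneg _)
  have hq : (k : ℝ) / m ∈ Set.Icc (0 : ℝ) 1 :=
    ⟨by positivity, (div_le_one hm0).2 (by exact_mod_cast hkm)⟩
  have hpow : ∀ (n : ℕ) (x y : ℝ), 0 < y → (n : ℝ) = m * x →
      y ^ n * Real.exp (m * (x * Real.log (x / y))) = x ^ n := by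
    intro n x y hy hn
    rw [← mul_assoc, ← hn, Real.exp_nat_mul]
    rcases Nat.eq_zero_or_pos n with h | h
    · simp [h]
    · have hx : 0 < x := by
        have : (0 : ℝ) < n := by exact_mod_cast h
        rw [hn] at this
        exact pos_of_mul_pos_right this hm0.le
      rw [Real.exp_log (by positivity), ← mul_pow, mul_div_cancel₀ _ hy.ne']
  rw [← hpow k (k / m) p h0 (by field_simp),
    ← hpow (m - k) (1 - k / m) (1 - p) (sub_pos.2 h1) (by rw [Nat.cast_sub hkm]; field_simp),
    mul_mul_mul_comm, ← Real.exp_add, ← mul_add, inv_mul_eq_div]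
  have := riskGap_le_binEntropyRel hq ⟨h0, h1⟩
  rw [binEntropyRel] at this
  have h1' : 0 ≤ 1 - p := sub_nonneg.2 hp.2
  gcongr

theorem integral_mem_Icc_of_forall_mem {Z : Type*} [MeasurableSpace Z] (μ : Measure Z)
    [IsProbabilityMeasure μ] {X : Z → ℝ} (hX01 : ∀ z, X z ∈ Set.Icc (0 : ℝ) 1) :
    ∫ z, X z ∂μ ∈ Set.Icc (0 : ℝ) 1 := by
  refine ⟨integral_nonneg fun z => (hX01 z).1, ?_⟩
  calc ∫ z, X z ∂μ ≤ ∫ _, (1 : ℝ) ∂μ :=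
        integral_mono_of_nonneg (.of_forall fun z => (hX01 z).1) (integrable_const _)
          (.of_forall fun z => (hX01 z).2)
    _ = 1 := by simp

theorem integrable_of_forall_mem_Icc {Z : Type*} [MeasurableSpace Z] (μ : Measure Z)
    [IsFiniteMeasure μ] {X : Z → ℝ} (hX : Measurable X)
    (hX01 : ∀ z, X z ∈ Set.Icc (0 : ℝ) 1) : Integrable X μ :=
  Integrable.of_bound hX.aestronglyMeasurable 1 (.of_forall fun z => by
    rw [Real.norm_eq_abs, abs_of_nonneg (hX01 z).1]; exact (hX01 z).2)

theorem integral_exp_riskGap_le {Z : Type*} [MeasurableSpace Z] (μ : Measure Z)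
    [IsProbabilityMeasure μ] {X : Z → ℝ} (hX : Measurable X)
    (hX01 : ∀ z, X z ∈ Set.Icc (0 : ℝ) 1) {m : ℕ} (hm : 1 ≤ m) :
    ∫ T : Fin m → Z, Real.exp (m * riskGap ((m : ℝ)⁻¹ * ∑ j, X (T j)) (∫ z, X z ∂μ))
      ∂(Measure.pi fun _ => μ) ≤ 2 * Real.sqrt m := by
  set p := ∫ z, X z ∂μ with hp
  have hXint : Integrable X μ := integrable_of_forall_mem_Icc μ hX hX01
  have hp01 : p ∈ Set.Icc (0 : ℝ) 1 := integral_mem_Icc_of_forall_mem μ hX01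
  set φ : ℝ → ℝ := fun y => Real.exp (m * riskGap ((m : ℝ)⁻¹ * y) p) with hφ
  have hconv : ConvexOn ℝ Set.univ φ := convexOn_exp_mul_riskGap (Nat.cast_nonneg m) _ p
  have hterm : ∀ t : Finset (Fin m), Integrable (fun T : Fin m → Z =>
      (∏ i, if i ∈ t then X (T i) else 1 - X (T i)) * φ (0 + #t)) (Measure.pi fun _ => μ) := by
    intro t
    refine Integrable.mul_const ?_ _
    refine Integrable.fintype_prod (f := fun i z => if i ∈ t then X z else 1 - X z) fun i => ?_
    split_ifs
    · exact hXint
    · exact (integrable_const 1).sub hXint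
  calc ∫ T : Fin m → Z, φ (∑ j, X (T j)) ∂(Measure.pi fun _ => μ)
      ≤ ∫ T : Fin m → Z, ∑ t ∈ (univ : Finset (Fin m)).powerset,
          (∏ i, if i ∈ t then X (T i) else 1 - X (T i)) * φ (0 + #t)
          ∂(Measure.pi fun _ => μ) := by
        refine integral_mono_of_nonneg (.of_forall fun T => (Real.exp_pos _).le)
          (integrable_finsetSum _ fun t _ => hterm t) (.of_forall fun T => ?_)
        have := hconv.le_sum_powerset univ (fun j => X (T j)) (fun j => hX01 _) 0
        rwa [zero_add] at this
    _ = ∑ t ∈ (univ : Finset (Fin m)).powerset, p ^ #t * (1 - p) ^ (m - #t) * φ #t := by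
        rw [integral_finsetSum _ fun t _ => hterm t]
        refine Finset.sum_congr rfl fun t _ => ?_
        rw [integral_mul_const, zero_add,
          integral_fintype_prod_eq_prod (fun i z => if i ∈ t then X z else 1 - X z)]
        have hfac : ∀ i : Fin m, ∫ z, (if i ∈ t then X z else 1 - X z) ∂μ
            = if i ∈ t then p else 1 - p := by
          intro i
          split_ifs
          · rfl
          · rw [integral_sub (integrable_const _) hXint]; simp [hp]
        simp_rw [hfac]
        rw [Finset.prod_ite, Finset.prod_const, Finset.prod_const]
        congr 3
        · simp
        · rw [Finset.filter_not, Finset.card_sdiff]; simp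
    _ = ∑ k ∈ range (m + 1), (m.choose k : ℝ) * (p ^ k * (1 - p) ^ (m - k) * φ k) := by
        rw [Finset.sum_powerset_apply_card (fun k => p ^ k * (1 - p) ^ (m - k) * φ k)]
        simp [nsmul_eq_mul]
    _ ≤ 2 * Real.sqrt m := sum_binomial_exp_riskGap_le hm hp01

/-- The Donsker--Varadhan change-of-measure inequality for bounded functions. -/
theorem integral_le_integral_llr_add_log {H : Type*} [MeasurableSpace H] (Q P : Measure H)
    [IsProbabilityMeasure Q] [IsProbabilityMeasure P] (hQP : Q ≪ P)
    (hint : Integrable (llr Q P) Q) {f : H → ℝ} (hf : Measurable f) {B : ℝ}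
    (hfB : ∀ h, |f h| ≤ B) :
    ∫ h, f h ∂Q ≤ ∫ h, llr Q P h ∂Q + Real.log (∫ h, Real.exp (f h) ∂P) := by
  have hfQ : Integrable f Q := Integrable.of_bound hf.aestronglyMeasurable B
    (.of_forall fun h => hfB h)
  have hexp : Integrable (fun h => Real.exp (f h)) P :=
    Integrable.of_bound hf.exp.aestronglyMeasurable (Real.exp B) (.of_forall fun h => by
      rw [Real.norm_eq_abs, Real.abs_exp]
      exact Real.exp_le_exp.2 ((le_abs_self _).trans (hfB h)))
  have : IsProbabilityMeasure (P.tilted f) := isProbabilityMeasure_tilted hexp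
  have hnonneg := InformationTheory.integral_llr_add_sub_measure_univ_nonneg
    (hQP.trans (absolutelyContinuous_tilted hexp)) (integrable_llr_tilted_right hQP hfQ hint hexp)
  rw [integral_llr_tilted_right hQP hfQ hexp hint, probReal_univ, probReal_univ] at hnonneg
  linarith

theorem risk_le_of_riskGap_le {r q e : ℝ} (hq : 0 ≤ q) (he : 0 ≤ e) (hr : 0 ≤ r)
    (hquad : ∀ t, 0 ≤ t → 4 * t * (r - q) - 2 * t ^ 2 ≤ e)
    (hlin : ∀ t, 0 ≤ t → t * (r - q) - t ^ 2 * r / 2 ≤ e) :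
    r ≤ q + min (e + Real.sqrt (e * (e + 2 * q))) (Real.sqrt (e / 2)) := by
  rcases le_total r q with h | h
  · have : 0 ≤ min (e + Real.sqrt (e * (e + 2 * q))) (Real.sqrt (e / 2)) :=
      le_min (by positivity) (by positivity)
    linarith
  have hd : 0 ≤ r - q := sub_nonneg.2 h
  suffices r - q ≤ min (e + Real.sqrt (e * (e + 2 * q))) (Real.sqrt (e / 2)) by linarith
  refine le_min ?_ (Real.le_sqrt_of_sq_le (by linarith [hquad _ hd]))
  rcases hr.eq_or_lt with h0 | h0
  · have : 0 ≤ e + Real.sqrt (e * (e + 2 * q)) := by positivity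
    linarith
  have hdiv := hlin ((r - q) / r) (by positivity)
  have hsq : (r - q) ^ 2 ≤ 2 * e * r := by
    have e1 : (r - q) / r * (r - q) - ((r - q) / r) ^ 2 * r / 2 = (r - q) ^ 2 / (2 * r) := by
      field_simp; ring
    rw [e1, div_le_iff₀ (by positivity)] at hdiv
    linarith
  have : r - q - e ≤ Real.sqrt (e * (e + 2 * q)) := Real.le_sqrt_of_sq_le (by nlinarith)
  linarith

/-- The identification of a sample of size `N` with its prefix of size `M` and the rest. -/
def splitEquiv {N M : ℕ} (hMN : M ≤ N) : Fin M ⊕ Fin (N - M) ≃ Fin N :=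
  finSumFinEquiv.trans (finCongr (Nat.add_sub_of_le hMN))

theorem measurePreserving_split {Z : Type*} [MeasurableSpace Z] (μ : Measure Z)
    [IsProbabilityMeasure μ] {N M : ℕ} (hMN : M ≤ N) :
    MeasurePreserving (fun S : Fin N → Z =>
      (fun j => S (splitEquiv hMN (Sum.inl j)), fun j => S (splitEquiv hMN (Sum.inr j))))
      (Measure.pi fun _ => μ) ((Measure.pi fun _ => μ).prod (Measure.pi fun _ => μ)) :=
  (measurePreserving_sumPiEquivProdPi fun _ => μ).comp
    (measurePreserving_piCongrLeft (fun _ : Fin N => μ) (splitEquiv hMN)).symm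

/-- Average of the losses of `h` over the sample `T`. -/
noncomputable def empRisk {Z H : Type*} (ℓ : H → Z → ℝ) {m : ℕ} (T : Fin m → Z) (h : H) : ℝ :=
  (m : ℝ)⁻¹ * ∑ j, ℓ h (T j)

theorem empRisk_mem_Icc {Z H : Type*} {ℓ : H → Z → ℝ}
    (hbound : ∀ h z, ℓ h z ∈ Set.Icc (0 : ℝ) 1) {m : ℕ} (T : Fin m → Z) (h : H) :
    empRisk ℓ T h ∈ Set.Icc (0 : ℝ) 1 := by
  refine ⟨mul_nonneg (by positivity) (Finset.sum_nonneg fun j _ => (hbound _ _).1), ?_⟩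
  rw [empRisk, inv_mul_eq_div]
  refine div_le_one_of_le₀ ?_ (Nat.cast_nonneg m)
  calc ∑ j, ℓ h (T j) ≤ ∑ _j : Fin m, (1 : ℝ) := Finset.sum_le_sum fun j _ => (hbound _ _).2
    _ = m := by simp

theorem measurable_riskGap : Measurable (Function.uncurry riskGap) := by
  unfold riskGap Function.uncurry
  fun_prop

/-- Scaled gap between the true and the empirical risk of a hypothesis. -/
noncomputable def sampleGap {Z H : Type*} [MeasurableSpace Z] {m : ℕ} (μ : Measure Z)
    (ℓ : H → Z → ℝ) (T : Fin m → Z) (h : H) : ℝ :=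
  m * riskGap (empRisk ℓ T h) (∫ z, ℓ h z ∂μ)

theorem sampleGap_nonneg {Z H : Type*} [MeasurableSpace Z] {m : ℕ} (μ : Measure Z)
    {ℓ : H → Z → ℝ} (T : Fin m → Z) (h : H) : 0 ≤ sampleGap μ ℓ T h :=
  mul_nonneg (Nat.cast_nonneg m) (riskGap_nonneg _ _)

theorem abs_sampleGap_le {Z H : Type*} [MeasurableSpace Z] {m : ℕ} (μ : Measure Z)
    [IsProbabilityMeasure μ] {ℓ : H → Z → ℝ} (hbound : ∀ h z, ℓ h z ∈ Set.Icc (0 : ℝ) 1)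
    (T : Fin m → Z) (h : H) : |sampleGap μ ℓ T h| ≤ m * 2 := by
  rw [abs_of_nonneg (sampleGap_nonneg μ T h)]
  exact mul_le_mul_of_nonneg_left (riskGap_le_two (empRisk_mem_Icc hbound T h).1
    (integral_mem_Icc_of_forall_mem μ (hbound h))) (Nat.cast_nonneg m)

section Sample

variable {Z H : Type*} [MeasurableSpace Z] [MeasurableSpace H] (μ : Measure Z)
  [IsProbabilityMeasure μ] {ℓ : H → Z → ℝ} {m : ℕ}

theorem measurable_trueRisk (hmeas : Measurable (Function.uncurry ℓ)) :
    Measurable fun h => ∫ z, ℓ h z ∂μ :=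
  (hmeas.stronglyMeasurable.integral_prod_right' (ν := μ)).measurable

theorem measurable_empRisk (hmeas : Measurable (Function.uncurry ℓ)) :
    Measurable fun x : (Fin m → Z) × H => empRisk ℓ x.1 x.2 := by
  refine Measurable.const_mul (Finset.measurable_sum _ fun j _ => ?_) _
  exact hmeas.comp (measurable_snd.prodMk ((measurable_pi_apply j).comp measurable_fst))

theorem measurable_sampleGap (hmeas : Measurable (Function.uncurry ℓ)) :
    Measurable fun x : (Fin m → Z) × H => sampleGap μ ℓ x.1 x.2 :=
  (measurable_riskGap.comp ((measurable_empRisk hmeas).prodMk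
    ((measurable_trueRisk μ hmeas).comp measurable_snd))).const_mul _

theorem lintegral_exp_sampleGap_le (hmeas : Measurable (Function.uncurry ℓ))
    (hbound : ∀ h z, ℓ h z ∈ Set.Icc (0 : ℝ) 1) (hm : 1 ≤ m) (h : H) :
    ∫⁻ T : Fin m → Z, ENNReal.ofReal (Real.exp (sampleGap μ ℓ T h)) ∂(Measure.pi fun _ => μ)
      ≤ ENNReal.ofReal (2 * Real.sqrt m) := by
  have hgap : Measurable fun T : Fin m → Z => sampleGap μ ℓ T h :=
    (measurable_sampleGap μ hmeas).comp (measurable_id.prodMk measurable_const)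
  rw [← ofReal_integral_eq_lintegral_ofReal _ (.of_forall fun T => (Real.exp_pos _).le)]
  · exact ENNReal.ofReal_le_ofReal (integral_exp_riskGap_le μ
      (hmeas.comp (measurable_const.prodMk measurable_id)) (hbound h) hm)
  · exact Integrable.of_bound hgap.exp.aestronglyMeasurable (Real.exp (m * 2))
      (.of_forall fun T => by
        rw [Real.norm_eq_abs, Real.abs_exp]
        exact Real.exp_le_exp.2 ((le_abs_self _).trans (abs_sampleGap_le μ hbound T h)))

/-- Deterministic part of the bound: if the exponential moment of the gap under the prior is at
most `C`, then every posterior satisfies the risk bound. -/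
theorem risk_le_of_lintegral_exp_le (hmeas : Measurable (Function.uncurry ℓ))
    (hbound : ∀ h z, ℓ h z ∈ Set.Icc (0 : ℝ) 1) (hm : 1 ≤ m) (T : Fin m → Z)
    (P Q : Measure H) [IsProbabilityMeasure P] [IsProbabilityMeasure Q] {C : ℝ} (hC : 0 < C)
    (hP : ∫⁻ h, ENNReal.ofReal (Real.exp (sampleGap μ ℓ T h)) ∂P ≤ ENNReal.ofReal C)
    {ε : ℝ≥0∞} (hε : ε = (klDiv Q P + ENNReal.ofReal (Real.log C)) / ENNReal.ofReal m) :
    ENNReal.ofReal (∫ h, (∫ z, ℓ h z ∂μ) ∂Q) ≤ ENNReal.ofReal (∫ h, empRisk ℓ T h ∂Q) +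
      min (ε + (ε * (ε + 2 * ENNReal.ofReal (∫ h, empRisk ℓ T h ∂Q))) ^ ((1 : ℝ) / 2))
        ((ε / 2) ^ ((1 : ℝ) / 2)) := by
  have hm0 : (0 : ℝ) < m := by exact_mod_cast hm
  unfold klDiv at hε
  split_ifs at hε with hac
  swap
  · have htop : ε = ⊤ := by
      rw [hε, top_add, ENNReal.top_div_of_ne_top ENNReal.ofReal_ne_top]
    simp [htop, ENNReal.top_div_of_ne_top]
  set K := ∫ h, Real.log ((Q.rnDeriv P h).toReal) ∂Q with hK
  set e : ℝ := (max K 0 + max (Real.log C) 0) / m with he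
  have he0 : 0 ≤ e := by positivity
  have hεe : ε = ENNReal.ofReal e := by
    rw [hε, he, ENNReal.ofReal_div_of_pos hm0, ENNReal.ofReal_add (by positivity) (by positivity),
      ENNReal.ofReal_max, ENNReal.ofReal_max]
    simp
  have hgapmeas : Measurable (sampleGap μ ℓ T) :=
    (measurable_sampleGap μ hmeas).comp (measurable_const.prodMk measurable_id)
  have hgapint : Integrable (sampleGap μ ℓ T) Q :=
    Integrable.of_bound hgapmeas.aestronglyMeasurable (m * 2)
      (.of_forall fun h => abs_sampleGap_le μ hbound T h)
  have hexpP : Integrable (fun h => Real.exp (sampleGap μ ℓ T h)) P :=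
    Integrable.of_bound hgapmeas.exp.aestronglyMeasurable (Real.exp (m * 2))
      (.of_forall fun h => by
        rw [Real.norm_eq_abs, Real.abs_exp]
        exact Real.exp_le_exp.2 ((le_abs_self _).trans (abs_sampleGap_le μ hbound T h)))
  have hgap : ∫ h, sampleGap μ ℓ T h ∂Q ≤ m * e := by
    have hdv := integral_le_integral_llr_add_log Q P hac.1 hac.2 hgapmeas
      (abs_sampleGap_le μ hbound T)
    have hlog : Real.log (∫ h, Real.exp (sampleGap μ ℓ T h) ∂P) ≤ Real.log C := by
      refine Real.log_le_log (integral_exp_pos hexpP) ?_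
      rw [← ENNReal.ofReal_le_ofReal_iff hC.le, ofReal_integral_eq_lintegral_ofReal hexpP
        (.of_forall fun h => (Real.exp_pos _).le)]
      exact hP
    have hme : m * e = max K 0 + max (Real.log C) 0 := by
      rw [he]; field_simp
    rw [hme]
    exact hdv.trans (add_le_add (le_max_left K 0) (hlog.trans (le_max_left _ 0)))
  have htrue : Integrable (fun h => ∫ z, ℓ h z ∂μ) Q :=
    integrable_of_forall_mem_Icc Q (measurable_trueRisk μ hmeas)
      fun h => integral_mem_Icc_of_forall_mem μ (hbound h)
  have hemp : Integrable (empRisk ℓ T) Q :=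
    integrable_of_forall_mem_Icc Q
      ((measurable_empRisk hmeas).comp (measurable_const.prodMk measurable_id))
      (empRisk_mem_Icc hbound T)
  set r := ∫ h, (∫ z, ℓ h z ∂μ) ∂Q with hr
  set q := ∫ h, empRisk ℓ T h ∂Q with hq
  have hq0 : 0 ≤ q := integral_nonneg fun h => (empRisk_mem_Icc hbound T h).1
  have hr0 : 0 ≤ r := integral_nonneg fun h => (integral_mem_Icc_of_forall_mem μ (hbound h)).1
  have haffine : ∀ a b c : ℝ, (∀ h, a * (∫ z, ℓ h z ∂μ) - b * empRisk ℓ T h - c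
      ≤ riskGap (empRisk ℓ T h) (∫ z, ℓ h z ∂μ)) → a * r - b * q - c ≤ e := by
    intro a b c h
    have hdiff : Integrable (fun h => a * (∫ z, ℓ h z ∂μ) - b * empRisk ℓ T h) Q :=
      (htrue.const_mul a).sub (hemp.const_mul b)
    have hint : ∫ h, (m * (a * (∫ z, ℓ h z ∂μ) - b * empRisk ℓ T h - c)) ∂Q
        = m * (a * r - b * q - c) := by
      rw [integral_const_mul, integral_sub hdiff (integrable_const c),
        integral_sub (htrue.const_mul a) (hemp.const_mul b),
        integral_const_mul, integral_const_mul, integral_const, probReal_univ, one_smul]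
    have hle := integral_mono
      ((hdiff.sub (integrable_const c)).const_mul (m : ℝ)) hgapint
      fun h' => mul_le_mul_of_nonneg_left (h h') hm0.le
    exact le_of_mul_le_mul_left ((hint ▸ hle).trans hgap) hm0
  have hreal := risk_le_of_riskGap_le hq0 he0 hr0
    (fun t ht => by
      have := haffine (4 * t) (4 * t) (2 * t ^ 2) fun h => by
        have := quadratic_le_riskGap (empRisk ℓ T h) (∫ z, ℓ h z ∂μ) ht
        linarith
      linarith)
    (fun t ht => by
      have := haffine (t - t ^ 2 / 2) t 0 fun h => by
        have := linear_le_riskGap (empRisk_mem_Icc hbound T h).1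
          (integral_mem_Icc_of_forall_mem μ (hbound h)).1 ht
        linarith
      linarith)
  have h2 : (2 : ℝ≥0∞) = ENNReal.ofReal 2 := by simp
  rw [hεe, h2, ← ENNReal.ofReal_mul (by norm_num), ← ENNReal.ofReal_add he0 (by positivity),
    ← ENNReal.ofReal_mul he0, ENNReal.ofReal_rpow_of_nonneg (by positivity) (by norm_num),
    ← ENNReal.ofReal_div_of_pos (by norm_num),
    ENNReal.ofReal_rpow_of_nonneg (by positivity) (by norm_num),
    ← ENNReal.ofReal_add he0 (by positivity), ← ENNReal.ofReal_min,
    ← ENNReal.ofReal_add hq0 (by positivity), ← Real.sqrt_eq_rpow, ← Real.sqrt_eq_rpow]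
  exact ENNReal.ofReal_le_ofReal hreal

theorem measurable_lintegral_exp_sampleGap {Y : Type*} [MeasurableSpace Y]
    (hmeas : Measurable (Function.uncurry ℓ)) (κ : ProbabilityTheory.Kernel Y H)
    [ProbabilityTheory.IsMarkovKernel κ] :
    Measurable fun x : Y × (Fin m → Z) =>
      ∫⁻ h, ENNReal.ofReal (Real.exp (sampleGap μ ℓ x.2 h)) ∂(κ x.1) := by
  have hF : Measurable fun u : (Y × (Fin m → Z)) × H =>
      ENNReal.ofReal (Real.exp (sampleGap μ ℓ u.1.2 u.2)) :=
    ((measurable_sampleGap μ hmeas).comp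
      ((measurable_snd.comp measurable_fst).prodMk measurable_snd)).exp.ennreal_ofReal
  exact Measurable.lintegral_kernel_prod_right' (κ := κ.comap Prod.fst measurable_fst) hF

/-- With a prior depending only on the first block of a split sample, the exponential moment of
the gap on the second block has the same bound as for a fixed prior. -/
theorem lintegral_lintegral_exp_sampleGap_le {Y : Type*} [MeasurableSpace Y] (ν : Measure Y)
    [IsProbabilityMeasure ν] (hmeas : Measurable (Function.uncurry ℓ))
    (hbound : ∀ h z, ℓ h z ∈ Set.Icc (0 : ℝ) 1) (hm : 1 ≤ m) (κ : ProbabilityTheory.Kernel Y H)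
    [ProbabilityTheory.IsMarkovKernel κ] :
    ∫⁻ x : Y × (Fin m → Z), ∫⁻ h, ENNReal.ofReal (Real.exp (sampleGap μ ℓ x.2 h)) ∂(κ x.1)
      ∂(ν.prod (Measure.pi fun _ => μ)) ≤ ENNReal.ofReal (2 * Real.sqrt m) := by
  have hF : Measurable (Function.uncurry fun (T : Fin m → Z) (h : H) =>
      ENNReal.ofReal (Real.exp (sampleGap μ ℓ T h))) :=
    (measurable_sampleGap μ hmeas).exp.ennreal_ofReal
  have hblock : ∀ y, ∫⁻ T : Fin m → Z, ∫⁻ h, ENNReal.ofReal (Real.exp (sampleGap μ ℓ T h)) ∂(κ y)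
      ∂(Measure.pi fun _ => μ) ≤ ENNReal.ofReal (2 * Real.sqrt m) := by
    intro y
    rw [lintegral_lintegral_swap hF.aemeasurable]
    refine (lintegral_mono fun h => lintegral_exp_sampleGap_le μ hmeas hbound hm h).trans ?_
    rw [lintegral_const, measure_univ, mul_one]
  rw [lintegral_prod _ (measurable_lintegral_exp_sampleGap μ hmeas κ).aemeasurable]
  refine (lintegral_mono hblock).trans ?_
  rw [lintegral_const, measure_univ, mul_one]

end Sample

/-- Theorem 1: data-dependent-prior PAC-Bayes bound: for a
`[0,1]`-valued loss, sample size `N`, prefix size `M < N` with `α = M/N`, a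
measurable data-dependent prior `P` (depending only on the first `M` points),
and `δ ∈ (0,1)`, with probability at least `1 - δ` over `S ~ 𝒟^N`,
simultaneously for all posteriors `Q`:
`R_𝒟(Q) ≤ R̂_{S∖S_P}(Q) + min( ε + √(ε(ε + 2 R̂_{S∖S_P}(Q))), √(ε/2) )`,
where `ε = (KL(Q‖P(S_P)) + log(2√((1-α)N)/δ)) / ((1-α)N)` (computed in `ℝ≥0∞`,
so that the bound is trivially true when the KL divergence is infinite). -/
theorem pac_bayes_data_dependent_prior
    {Z H : Type*} [MeasurableSpace Z] [MeasurableSpace H]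
    (𝒟 : Measure Z) [IsProbabilityMeasure 𝒟]
    (ℓ : H → Z → ℝ) (hmeas : Measurable (Function.uncurry ℓ))
    (hbound : ∀ h z, ℓ h z ∈ Set.Icc (0:ℝ) 1)
    (N M : ℕ) (hMN : M < N)
    (P : (Fin M → Z) → Measure H) (hPmeas : Measurable P)
    (hPprob : ∀ s, IsProbabilityMeasure (P s))
    (δ : ℝ) (hδ : δ ∈ Set.Ioo (0:ℝ) 1) :
    ENNReal.ofReal (1 - δ) ≤
      (Measure.pi fun _ : Fin N => 𝒟)
        {S : Fin N → Z | ∀ Q : Measure H, IsProbabilityMeasure Q →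
          (let α : ℝ := (M : ℝ) / (N : ℝ)
           let SP : Fin M → Z := fun j => S ⟨j.1, by have := j.isLt; omega⟩
           let Remp : ℝ :=
             (1 / ((1 - α) * (N : ℝ))) *
               ∑ j : Fin (N - M), ∫ h, ℓ h (S ⟨M + j.1, by have := j.isLt; omega⟩) ∂Q
           let ε : ℝ≥0∞ :=
             (klDiv Q (P SP)
                 + ENNReal.ofReal (Real.log (2 * Real.sqrt ((1 - α) * (N : ℝ)) / δ)))
               / ENNReal.ofReal ((1 - α) * (N : ℝ))
           ENNReal.ofReal (∫ h, (∫ z, ℓ h z ∂𝒟) ∂Q)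
             ≤ ENNReal.ofReal Remp
               + min (ε + (ε * (ε + 2 * ENNReal.ofReal Remp)) ^ ((1:ℝ) / 2))
                   ((ε / 2) ^ ((1:ℝ) / 2)))} := by
  have hδ0 : 0 < δ := hδ.1
  have hN0 : (0 : ℝ) < N := by exact_mod_cast (Nat.zero_le M).trans_lt hMN
  have hm : 1 ≤ N - M := by omega
  have hm0 : (0 : ℝ) < (N - M : ℕ) := by exact_mod_cast hm
  have hcard : (1 - (M : ℝ) / N) * N = (N - M : ℕ) := by
    rw [Nat.cast_sub hMN.le]; field_simp
  let κ : ProbabilityTheory.Kernel (Fin M → Z) H := ⟨P, hPmeas⟩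
  have : ProbabilityTheory.IsMarkovKernel κ := ⟨hPprob⟩
  have hg := measurable_lintegral_exp_sampleGap (m := N - M) 𝒟 hmeas κ
  have hgle := lintegral_lintegral_exp_sampleGap_le 𝒟
    (Measure.pi fun _ : Fin M => 𝒟) hmeas hbound hm κ
  set g : (Fin M → Z) × (Fin (N - M) → Z) → ℝ≥0∞ := fun x =>
    ∫⁻ h, ENNReal.ofReal (Real.exp (sampleGap 𝒟 ℓ x.2 h)) ∂(κ x.1)
  have hsplit := measurePreserving_split 𝒟 hMN.le
  set split := fun S : Fin N → Z =>
    (fun j => S (splitEquiv hMN.le (Sum.inl j)), fun j => S (splitEquiv hMN.le (Sum.inr j)))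
  set C : ℝ := 2 * Real.sqrt (N - M : ℕ) / δ with hCdef
  have hC : 0 < C := by positivity
  have hgS : Measurable fun S => g (split S) := hg.comp hsplit.measurable
  have hbad : (Measure.pi fun _ : Fin N => 𝒟) {S | ENNReal.ofReal C ≤ g (split S)}
      ≤ ENNReal.ofReal δ := by
    refine (meas_ge_le_lintegral_div hgS.aemeasurable (by simpa using hC)
      ENNReal.ofReal_ne_top).trans ?_
    rw [hsplit.lintegral_comp hg]
    refine ENNReal.div_le_of_le_mul (hgle.trans (le_of_eq ?_))
    rw [← ENNReal.ofReal_mul hδ0.le, hCdef]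
    congr 1
    field_simp
  have hgood : ENNReal.ofReal (1 - δ) ≤
      (Measure.pi fun _ : Fin N => 𝒟) {S | ENNReal.ofReal C ≤ g (split S)}ᶜ := by
    rw [prob_compl_eq_one_sub (measurableSet_le measurable_const hgS),
      ENNReal.ofReal_sub _ hδ0.le, ENNReal.ofReal_one]
    exact tsub_le_tsub_left hbad 1
  refine hgood.trans (measure_mono fun S hS => ?_)
  intro Q hQ α SP Remp ε
  have := hPprob SP
  have hRemp : Remp = ∫ h, empRisk ℓ (split S).2 h ∂Q := by
    simp only [Remp, empRisk, α]
    rw [hcard, integral_const_mul, integral_finsetSum, one_div]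
    · rfl
    intro j _
    exact integrable_of_forall_mem_Icc Q (hmeas.comp (measurable_id.prodMk measurable_const))
      fun h => hbound h _
  rw [hRemp]
  refine risk_le_of_lintegral_exp_le 𝒟 hmeas hbound hm (split S).2 (P SP) Q hC
    (le_of_lt (not_le.1 hS)) ?_
  simp only [ε, α, hcard, hCdef]
end

section
/- (Lemma 2, small-drift regime: quadratic dependence of the KL term on the drift.) Fix λ⁰ ∈ (0,1) and η ∈ (−1, 1), and set λ = λ⁰ (1 + η(1−λ⁰)) ∈ (0,1). Then klbin(λ‖λ⁰) ≤ η² λ⁰ (1−λ⁰). In particular, in the small-drift regime the KL contribution to the PAC-Bayes bound is quadratic in the normalized drift η. -/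
/-- Binary Kullback--Leibler divergence
`klbin(q‖p) = q log(q/p) + (1-q) log((1-q)/(1-p))` for `q, p ∈ (0,1)`. -/
noncomputable def klBinReal (q p : ℝ) : ℝ :=
  q * Real.log (q / p) + (1 - q) * Real.log ((1 - q) / (1 - p))

/-- The binary KL divergence is at most the binary chi-squared divergence. -/
theorem klBinReal_le_chiSq {q p : ℝ} (hq : q ∈ Set.Ioo (0:ℝ) 1) (hp : p ∈ Set.Ioo (0:ℝ) 1) :
    klBinReal q p ≤ (q - p) ^ 2 / (p * (1 - p)) := by
  obtain ⟨hq0, hq1⟩ := hq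
  obtain ⟨hp0, hp1⟩ := hp
  have hq' : 0 < 1 - q := sub_pos.2 hq1
  have hp' : 0 < 1 - p := sub_pos.2 hp1
  calc klBinReal q p
      ≤ q * (q / p - 1) + (1 - q) * ((1 - q) / (1 - p) - 1) :=
        add_le_add
          (mul_le_mul_of_nonneg_left (Real.log_le_sub_one_of_pos (div_pos hq0 hp0)) hq0.le)
          (mul_le_mul_of_nonneg_left (Real.log_le_sub_one_of_pos (div_pos hq' hp')) hq'.le)
    _ = (q - p) ^ 2 / (p * (1 - p)) := by
        field_simp
        ring

/-- Lemma 2, small-drift regime: for `λ⁰ ∈ (0,1)` and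
`η ∈ (-1,1)`, the probability `λ = λ⁰(1 + η(1-λ⁰))` lies in `(0,1)` and
`klbin(λ‖λ⁰) ≤ η² λ⁰ (1-λ⁰)`: the KL contribution to the PAC-Bayes bound is
quadratic in the normalized drift `η`. -/
theorem klbin_small_drift_quadratic_bound
    (lam0 η : ℝ) (hlam0 : lam0 ∈ Set.Ioo (0:ℝ) 1) (hη : η ∈ Set.Ioo (-1:ℝ) 1) :
    lam0 * (1 + η * (1 - lam0)) ∈ Set.Ioo (0:ℝ) 1
    ∧ klBinReal (lam0 * (1 + η * (1 - lam0))) lam0 ≤ η ^ 2 * lam0 * (1 - lam0) := by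
  obtain ⟨hp0, hp1⟩ := hlam0
  obtain ⟨hη0, hη1⟩ := hη
  have hp' : 0 < 1 - lam0 := sub_pos.2 hp1
  have hmem : lam0 * (1 + η * (1 - lam0)) ∈ Set.Ioo (0:ℝ) 1 := by
    constructor
    · apply mul_pos hp0
      nlinarith
    · have h : 0 < (1 - lam0) * (1 - lam0 * η) := mul_pos hp' (by nlinarith)
      linarith
  refine ⟨hmem, (klBinReal_le_chiSq hmem ⟨hp0, hp1⟩).trans_eq ?_⟩
  field_simp
  ring
end
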